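/- arXiv:2401.06058 — 3 statements merged into one kernel-verified Lean document; each statement's English description precedes it below -/
import Mathlib

section
/- For any integer n ≥ 1 and any integers a_1, …, a_n, b_1, …, b_n, the abelianization of the presented group G(a,b) is the trivial group if and only if det M(a,b) = 1 or det M(a,b) = −1, equivalently if and only if ∏_{i=1}^n a_i − ∑_{i=1}^n b_i ∏_{j≠i} a_j = ±1. -/
open scoped commutatorElement

/-- Relations of the presentation
`⟨γ₀,…,γₙ ∣ γ₁⋯γₙ = γ₀⁻¹, [γ₀,γᵢ] = 1, γᵢ^{aᵢ} γ₀^{bᵢ} = 1⟩`,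
where the generator `0 : Fin (n+1)` is `γ₀` and `i.succ` is `γᵢ`. -/
def homPlaneRels (n : ℕ) (a b : Fin n → ℤ) : Set (FreeGroup (Fin (n + 1))) :=
  {(List.ofFn fun i : Fin n => FreeGroup.of i.succ).prod * FreeGroup.of 0} ∪
    (Set.range fun i : Fin n =>
      ⁅FreeGroup.of (0 : Fin (n + 1)), FreeGroup.of i.succ⁆) ∪
    (Set.range fun i : Fin n =>
      FreeGroup.of i.succ ^ a i * FreeGroup.of (0 : Fin (n + 1)) ^ b i)

/-- The group `G(a,b)`. -/
def homPlaneGroup (n : ℕ) (a b : Fin n → ℤ) : Type :=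
  PresentedGroup (homPlaneRels n a b)

instance (n : ℕ) (a b : Fin n → ℤ) : Group (homPlaneGroup n a b) :=
  inferInstanceAs (Group (PresentedGroup (homPlaneRels n a b)))

/-- The matrix `M(a,b)` with diagonal entries `a i - b i` and off-diagonal
entries `-(b i)`. -/
def homPlaneMatrix (n : ℕ) (a b : Fin n → ℤ) : Matrix (Fin n) (Fin n) ℤ :=
  Matrix.of fun i j => if i = j then a i - b i else -(b i)

lemma det_field_aux {K : Type*} [Field K] {n : ℕ} (a b : Fin n → K) (ha : ∀ i, a i ≠ 0) :
    (Matrix.of fun i j => if i = j then a i - b i else -(b i)).det =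
      (∏ i : Fin n, a i) - (∑ i : Fin n, b i * ∏ j ∈ Finset.univ.erase i, a j) := by
  have hA : (Matrix.of fun i j => if i = j then a i - b i else -(b i)) =
      Matrix.diagonal a * (1 + Matrix.replicateCol Unit (fun i => -(b i / a i)) *
        Matrix.replicateRow Unit (fun _ => (1 : K))) := by
    ext i j
    have := ha i
    rw [Matrix.diagonal_mul]
    by_cases hij : i = j
    · subst hij
      simp [Matrix.mul_apply]
      field_simp
      ring
    · simp [Matrix.mul_apply, hij]
      field_simp
  rw [hA, Matrix.det_mul, Matrix.det_diagonal, Matrix.det_one_add_replicateCol_mul_replicateRow,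
    mul_add, mul_one, sub_eq_add_neg]
  congr 1
  simp only [dotProduct, one_mul, Finset.mul_sum, ← Finset.sum_neg_distrib]
  refine Finset.sum_congr rfl fun i _ => ?_
  rw [← Finset.mul_prod_erase Finset.univ a (Finset.mem_univ i)]
  have := ha i
  field_simp

lemma det_hom_aux {R S : Type*} [CommRing R] [CommRing S] (f : R →+* S) {n : ℕ} (a b : Fin n → R) :
    f (Matrix.of fun i j => if i = j then a i - b i else -(b i)).det =
      (Matrix.of fun i j => if i = j then f (a i) - f (b i) else -(f (b i))).det := by
  rw [RingHom.map_det]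
  congr 1
  ext i j
  by_cases hij : i = j <;> simp [hij]

open Polynomial in
lemma det_aux {n : ℕ} (a b : Fin n → ℤ) :
    (homPlaneMatrix n a b).det =
      (∏ i : Fin n, a i) - (∑ i : Fin n, b i * ∏ j ∈ Finset.univ.erase i, a j) := by
  have key : (Matrix.of fun i j => if i = j then (X + C (a i)) - C (b i) else -(C (b i))).det =
      (∏ i : Fin n, (X + C (a i))) -
        (∑ i : Fin n, C (b i) * ∏ j ∈ Finset.univ.erase i, (X + C (a j))) := by
    apply IsFractionRing.injective ℤ[X] (FractionRing ℤ[X])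
    rw [det_hom_aux (algebraMap ℤ[X] (FractionRing ℤ[X])) (fun i => X + C (a i)) (fun i => C (b i)),
      det_field_aux]
    · simp
    · intro i h
      rw [map_eq_zero_iff _ (IsFractionRing.injective ℤ[X] (FractionRing ℤ[X]))] at h
      exact Polynomial.X_add_C_ne_zero _ h
  have := congrArg (evalRingHom (0 : ℤ)) key
  rw [det_hom_aux (evalRingHom (0 : ℤ)) (fun i => X + C (a i)) (fun i => C (b i))] at this
  simpa [homPlaneMatrix, eval_prod, eval_finsetSum] using this

lemma row_aux {A : Type*} [AddCommGroup A] {n : ℕ} (a b : Fin n → ℤ) (g : Fin n → A) (i : Fin n) :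
    ∑ j, homPlaneMatrix n a b i j • g j = a i • g i - b i • ∑ j, g j := by
  have : ∀ j, homPlaneMatrix n a b i j • g j = (if i = j then a i • g i else 0) - b i • g j := by
    intro j
    by_cases hij : i = j
    · subst hij
      simp [homPlaneMatrix, sub_smul]
    · simp [homPlaneMatrix, hij]
  simp [this, Finset.sum_sub_distrib, Finset.smul_sum]

lemma core_aux {A : Type*} [AddCommGroup A] {n : ℕ} (M : Matrix (Fin n) (Fin n) ℤ)
    (hM : IsUnit M) (g : Fin n → A) (h : ∀ i, ∑ j, M i j • g j = 0) (k : Fin n) : g k = 0 := by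
  obtain ⟨N, hN⟩ := isUnit_iff_exists_inv'.1 hM
  have h1 : g k = ∑ j, (N * M) k j • g j := by
    simp [hN, Matrix.one_apply]
  rw [h1]
  simp only [Matrix.mul_apply, Finset.sum_smul, mul_smul]
  rw [Finset.sum_comm]
  simp [← Finset.smul_sum, h]

lemma sub_iff_unit (n : ℕ) (a b : Fin n → ℤ) :
    Subsingleton (Abelianization (homPlaneGroup n a b)) ↔ IsUnit (homPlaneMatrix n a b) := by
  constructor
  · intro hs
    let M := homPlaneMatrix n a b
    let S : AddSubgroup (Fin n → ℤ) := (Matrix.vecMulLinear M).range.toAddSubgroup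
    let Q := (Fin n → ℤ) ⧸ S
    let g : Fin n → Q := fun i => QuotientAddGroup.mk (Pi.single i 1)
    let f : Fin (n + 1) → Multiplicative Q :=
      Fin.cons (Multiplicative.ofAdd (-∑ i, g i)) (fun i => Multiplicative.ofAdd (g i))
    have hrow : ∀ i, a i • g i - b i • ∑ j, g j = 0 := by
      intro i
      rw [← row_aux]
      have : ∑ j, M i j • g j = QuotientAddGroup.mk' S (M i) := by
        conv_rhs => rw [pi_eq_sum_univ' (M i)]
        rw [map_sum]
        refine Finset.sum_congr rfl fun j _ => ?_
        rw [map_zsmul]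
        congr 2
      rw [this]
      refine (QuotientAddGroup.eq_zero_iff _).2 ⟨Pi.single i 1, ?_⟩
      simp
      rfl
    have hf : ∀ r ∈ homPlaneRels n a b, FreeGroup.lift f r = 1 := by
      rintro r ((rfl | ⟨i, rfl⟩) | ⟨i, rfl⟩)
      · rw [map_mul, map_list_prod, List.map_ofFn, List.prod_ofFn]
        simp [f]
        exact mul_inv_cancel _
      · rw [map_commutatorElement, commutatorElement_eq_one_iff_mul_comm]
        exact mul_comm _ _
      · simp only [map_mul, map_zpow, FreeGroup.lift_apply_of]
        simp only [f, Fin.cons_zero, Fin.cons_succ]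
        rw [← ofAdd_zsmul, ← ofAdd_zsmul, ← ofAdd_add, ← ofAdd_zero, ← hrow i, smul_neg,
          sub_eq_add_neg]
    let F : Abelianization (homPlaneGroup n a b) →* Multiplicative Q :=
      Abelianization.lift (PresentedGroup.toGroup hf)
    have hg : ∀ i, g i = 0 := by
      intro i
      have h1 : F (Abelianization.of (PresentedGroup.of (rels := homPlaneRels n a b) i.succ)) =
          Multiplicative.ofAdd (g i) := by
        refine (Abelianization.lift_apply_of _ _).trans ?_
        exact PresentedGroup.toGroup.of hf
      have h2 : ∀ x, F x = 1 := fun x => (congrArg F (Subsingleton.elim x 1)).trans (map_one F)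
      exact h1.symm.trans (h2 _)
    rw [← Matrix.vecMul_surjective_iff_isUnit]
    have : (Matrix.vecMulLinear M).range = ⊤ := by
      rw [eq_top_iff]
      intro v _
      rw [pi_eq_sum_univ' v]
      refine Submodule.sum_mem _ fun i _ => Submodule.smul_mem _ _ ?_
      have := (QuotientAddGroup.eq_zero_iff _).1 (hg i)
      exact this
    intro v
    exact LinearMap.range_eq_top.1 this v
  · intro hM
    let φ : FreeGroup (Fin (n + 1)) →* Abelianization (homPlaneGroup n a b) :=
      (Abelianization.of (G := homPlaneGroup n a b)).comp (PresentedGroup.mk (homPlaneRels n a b))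
    have hφ : Function.Surjective φ :=
      (QuotientGroup.mk_surjective).comp (PresentedGroup.mk_surjective _)
    have hr : ∀ r ∈ homPlaneRels n a b, φ r = 1 := by
      intro r h
      have : PresentedGroup.mk (homPlaneRels n a b) r = 1 :=
        (QuotientGroup.eq_one_iff _).2 (Subgroup.subset_normalClosure h)
      change Abelianization.of (G := homPlaneGroup n a b) (PresentedGroup.mk _ r) = 1
      rw [this]
      exact map_one _
    let g : Fin n → Additive (Abelianization (homPlaneGroup n a b)) :=
      fun i => Additive.ofMul (φ (FreeGroup.of i.succ))
    have h0 : Additive.ofMul (φ (FreeGroup.of 0)) = -∑ i, g i := by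
      have := hr _ (Or.inl (Or.inl rfl))
      rw [map_mul, map_list_prod, List.map_ofFn, List.prod_ofFn] at this
      rw [eq_neg_iff_add_eq_zero, add_comm]
      exact this
    have hg : ∀ i, g i = 0 := by
      refine core_aux _ hM g fun i => ?_
      rw [row_aux]
      have := hr _ (Or.inr ⟨i, rfl⟩)
      simp only [map_mul, map_zpow] at this
      have h2 : a i • g i + b i • Additive.ofMul (φ (FreeGroup.of 0)) = 0 := this
      rwa [h0, smul_neg, ← sub_eq_add_neg] at h2
    have h1 : φ = 1 := by
      refine FreeGroup.ext_hom _ _ fun i => ?_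
      refine Fin.cases ?_ (fun i => ?_) i
      · simp only [hg, Finset.sum_const_zero, neg_zero] at h0
        exact h0
      · exact hg i
    refine ⟨fun x y => ?_⟩
    obtain ⟨x, rfl⟩ := hφ x
    obtain ⟨y, rfl⟩ := hφ y
    simp [h1]

/-- The abelianization of `G(a,b)` is trivial iff `det M(a,b) = ±1`,
equivalently iff `∏ aᵢ − ∑ᵢ bᵢ ∏_{j≠i} aⱼ = ±1`. -/
theorem abelianization_trivial_iff (n : ℕ) (hn : 1 ≤ n) (a b : Fin n → ℤ) :
    (Subsingleton (Abelianization (homPlaneGroup n a b)) ↔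
        (homPlaneMatrix n a b).det = 1 ∨ (homPlaneMatrix n a b).det = -1) ∧
      (Subsingleton (Abelianization (homPlaneGroup n a b)) ↔
        (∏ i : Fin n, a i) -
            (∑ i : Fin n, b i * ∏ j ∈ Finset.univ.erase i, a j) = 1 ∨
          (∏ i : Fin n, a i) -
            (∑ i : Fin n, b i * ∏ j ∈ Finset.univ.erase i, a j) = -1) := by
  have h : Subsingleton (Abelianization (homPlaneGroup n a b)) ↔
      (homPlaneMatrix n a b).det = 1 ∨ (homPlaneMatrix n a b).det = -1 := by
    rw [sub_iff_unit, Matrix.isUnit_iff_isUnit_det, Int.isUnit_iff]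
  refine ⟨h, ?_⟩
  rw [h, det_aux]
end

section
/- For n = 2 and integers a_1, b_1, a_2, b_2 satisfying a_1a_2 − b_1a_2 − a_1b_2 = ±1, the presented group G(a,b) = ⟨γ_0, γ_1, γ_2 ∣ γ_1γ_2 = γ_0^{-1}, [γ_0, γ_1] = 1, [γ_0, γ_2] = 1, γ_1^{a_1} γ_0^{b_1} = 1, γ_2^{a_2} γ_0^{b_2} = 1⟩ is the trivial group. (This is the group-theoretic content of the claim that every homology plane obtained from the quasi-pencil L(1,3) is simply connected, hence contractible.) -/
open scoped commutatorElement

lemma aux_det {G : Type*} [Group G] {x z : G} (_hc : Commute x z) {p q r s : ℤ}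
    (h1 : x ^ p * z ^ q = 1) (h2 : x ^ r * z ^ s = 1)
    (hd : p * s - q * r = 1 ∨ p * s - q * r = -1) : x = 1 := by
  have e1 : x ^ p = z ^ (-q) := by rw [zpow_neg]; exact eq_inv_of_mul_eq_one_left h1
  have e2 : x ^ r = z ^ (-s) := by rw [zpow_neg]; exact eq_inv_of_mul_eq_one_left h2
  have e : x ^ (p * s - q * r) = 1 := by
    rw [zpow_sub, zpow_mul, mul_comm q r, zpow_mul, e1, e2, ← zpow_mul, ← zpow_mul,
      ← zpow_neg, ← zpow_add]
    have : -q * s + -(-s * q) = 0 := by ring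
    rw [this, zpow_zero]
  rcases hd with hd | hd <;> rw [hd] at e <;> simpa using e

lemma aux_grp {G : Type*} [Group G] {x y z : G} (h : x * y * z = 1) (hx : Commute x z)
    {a0 b0 a1 b1 : ℤ} (h1 : x ^ a0 * z ^ b0 = 1) (h2 : y ^ a1 * z ^ b1 = 1)
    (hd : a0 * a1 - b0 * a1 - a0 * b1 = 1 ∨ a0 * a1 - b0 * a1 - a0 * b1 = -1) :
    x = 1 ∧ y = 1 ∧ z = 1 := by
  have hy : y = x⁻¹ * z⁻¹ := by
    rw [eq_mul_inv_iff_mul_eq]; exact eq_inv_of_mul_eq_one_right (by rw [← mul_assoc]; exact h)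
  have h2x : x ^ (-a1) * z ^ (b1 - a1) = 1 := by
    rw [hy, (hx.inv_inv).mul_zpow, inv_zpow', inv_zpow', mul_assoc, ← zpow_add] at h2
    rw [← h2]; congr 2; ring
  have X : x = 1 := aux_det hx h1 h2x (by
      rcases hd with hd | hd
      · right; linarith
      · left; linarith)
  have Z : z = 1 := by
    have h1z := h1
    have h2z := h2x
    rw [(hx.zpow_zpow _ _).eq] at h1z h2z
    exact aux_det hx.symm h1z h2z (by
      rcases hd with hd | hd
      · left; linarith
      · right; linarith)
  exact ⟨X, by simp [hy, X, Z], Z⟩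

/-- For `n = 2`, if `a₁a₂ − b₁a₂ − a₁b₂ = ±1` then `G(a,b)` is trivial. -/
theorem homPlaneGroup_two_trivial (a b : Fin 2 → ℤ)
    (h : a 0 * a 1 - b 0 * a 1 - a 0 * b 1 = 1 ∨
      a 0 * a 1 - b 0 * a 1 - a 0 * b 1 = -1) :
    Subsingleton (homPlaneGroup 2 a b) := by
  have rel : ∀ w ∈ homPlaneRels 2 a b, PresentedGroup.mk (homPlaneRels 2 a b) w = 1 :=
    fun w hw => PresentedGroup.one_of_mem hw
  have r0 := rel _ (Or.inl (Or.inl rfl))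
  have r1 := rel _ (Or.inl (Or.inr ⟨0, rfl⟩))
  have r2 := rel _ (Or.inr ⟨0, rfl⟩)
  have r3 := rel _ (Or.inr ⟨1, rfl⟩)
  simp only [List.ofFn_succ, List.ofFn_zero, List.prod_cons, List.prod_nil, mul_one,
    map_mul, map_zpow, map_commutatorElement] at r0 r1 r2 r3
  obtain ⟨X, Y, Z⟩ := aux_grp r0 (commutatorElement_eq_one_iff_commute.mp r1).symm r2 r3 h
  have key : MonoidHom.id (PresentedGroup (homPlaneRels 2 a b)) = 1 := by
    apply PresentedGroup.ext
    intro i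
    fin_cases i
    · exact Z
    · exact X
    · exact Y
  have t : ∀ g : PresentedGroup (homPlaneRels 2 a b), g = 1 := fun g => DFunLike.congr_fun key g
  exact ⟨fun g k => (t g).trans (t k).symm⟩
end

section
/- For any integer n ≥ 3 and any integers a_1, …, a_n, b_1, …, b_n with each a_i ≥ 2, the presented group G(a,b) is nontrivial. (This is the group-theoretic content of the claim that for n ≥ 3 the homology planes obtained from the quasi-pencil L(1,n+1) are never contractible.) -/
open scoped commutatorElement

lemma hp_exists_root (m : ℕ) (hm : 2 ≤ m) :
    ∃ z w : ℂ, z * w = 1 ∧ z ^ m = -1 ∧ w ^ m = -1 ∧ z ≠ w := by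
  have hp := Complex.isPrimitiveRoot_exp (2 * m) (by omega)
  set z := Complex.exp (2 * Real.pi * Complex.I / ((2 * m : ℕ) : ℂ)) with hz
  have hz0 : z ≠ 0 := Complex.exp_ne_zero _
  have hzm : z ^ m = -1 := by
    have h1 : (z ^ m) ^ 2 = 1 := by
      rw [← pow_mul, mul_comm]; exact hp.pow_eq_one
    rcases mul_self_eq_one_iff.mp ((sq _).symm.trans h1) with h | h
    · exact absurd h (hp.pow_ne_one_of_pos_of_lt (by omega) (by omega))
    · exact h
  refine ⟨z, z⁻¹, mul_inv_cancel₀ hz0, hzm, by rw [inv_pow, hzm]; norm_num, fun h => ?_⟩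
  refine hp.pow_ne_one_of_pos_of_lt (l := 2) (by omega) (by omega) ?_
  calc z ^ 2 = z * z := sq z
    _ = z * z⁻¹ := by rw [← h]
    _ = 1 := mul_inv_cancel₀ hz0

lemma hp_pow_formula (A : Matrix (Fin 2) (Fin 2) ℂ) (z w : ℂ) (hzw : z * w = 1)
    (hA : A * A = (z + w) • A - 1) (k : ℕ) :
    (z - w) • A ^ (k + 1) = (z ^ (k + 1) - w ^ (k + 1)) • A - (z ^ k - w ^ k) • 1 := by
  induction k with
  | zero => simp
  | succ k ih =>
    rw [pow_succ, ← smul_mul_assoc, ih, sub_mul, smul_mul_assoc, hA, smul_mul_assoc, one_mul,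
      smul_sub, smul_smul]
    have e : (z ^ (k + 1 + 1) - w ^ (k + 1 + 1))
        = (z ^ (k + 1) - w ^ (k + 1)) * (z + w) - (z ^ k - w ^ k) := by
      have : z ^ k - w ^ k = (z ^ k - w ^ k) * (z * w) := by rw [hzw, mul_one]
      rw [this]; ring
    rw [e, sub_smul]
    module

lemma hp_sl_pow (A : Matrix.SpecialLinearGroup (Fin 2) ℂ) (m : ℕ) (hm : 2 ≤ m) (z w : ℂ)
    (hzw : z * w = 1) (hz : z ^ m = -1) (hw : w ^ m = -1) (hne : z ≠ w)
    (ht : A 0 0 + A 1 1 = z + w) : A ^ m ∈ Subgroup.center (Matrix.SpecialLinearGroup (Fin 2) ℂ) := by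
  have hd : A 0 0 * A 1 1 - A 0 1 * A 1 0 = 1 := by
    have := A.det_coe
    rwa [Matrix.det_fin_two] at this
  have hA : A.1 * A.1 = (z + w) • A.1 - 1 := by
    rw [← ht]
    ext i j
    fin_cases i <;> fin_cases j <;> simp [Matrix.mul_apply, Fin.sum_univ_two] <;>
      first | ring1 | linear_combination -hd
  obtain ⟨k, rfl⟩ : ∃ k, m = k + 1 := ⟨m - 1, by omega⟩
  have h := hp_pow_formula A.1 z w hzw hA k
  have hk : z ^ k - w ^ k = z - w := by
    have h1 : z ^ k = -w := by
      calc z ^ k = z ^ k * (z * w) := by rw [hzw, mul_one]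
        _ = z ^ (k + 1) * w := by ring
        _ = -w := by rw [hz]; ring
    have h2 : w ^ k = -z := by
      calc w ^ k = w ^ k * (z * w) := by rw [hzw, mul_one]
        _ = w ^ (k + 1) * z := by ring
        _ = -z := by rw [hw]; ring
    rw [h1, h2]; ring
  rw [hz, hw, hk, sub_self, zero_smul, zero_sub, ← smul_neg] at h
  have h' : A.1 ^ (k + 1) = -1 := smul_right_injective _ (sub_ne_zero.mpr hne) h
  rw [Subgroup.mem_center_iff]
  intro g
  apply Subtype.ext
  change g.1 * (A ^ (k + 1)).1 = (A ^ (k + 1)).1 * g.1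
  have h3 : (A ^ (k + 1)).1 = -1 := by
    rw [← h']; exact Matrix.SpecialLinearGroup.coe_pow A (k + 1)
  rw [h3]; simp

/-- Triangle groups are nontrivial. -/
lemma hp_triangle (p q r : ℕ) (hp : 2 ≤ p) (hq : 2 ≤ q) (hr : 2 ≤ r) :
    ∃ (H : Type) (_ : Group H) (x y z : H),
      x * y * z = 1 ∧ x ^ p = 1 ∧ y ^ q = 1 ∧ z ^ r = 1 ∧ x ≠ 1 := by
  obtain ⟨z₁, w₁, h₁, hz₁, hw₁, n₁⟩ := hp_exists_root p hp
  obtain ⟨z₂, w₂, h₂, hz₂, hw₂, n₂⟩ := hp_exists_root q hq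
  obtain ⟨z₃, w₃, h₃, hz₃, hw₃, n₃⟩ := hp_exists_root r hr
  let X : Matrix.SpecialLinearGroup (Fin 2) ℂ := ⟨!![z₁, 1; 0, w₁], by simp [Matrix.det_fin_two, h₁]⟩
  let Y : Matrix.SpecialLinearGroup (Fin 2) ℂ :=
    ⟨!![z₂, 0; z₃ + w₃ - z₁ * z₂ - w₁ * w₂, w₂], by simp [Matrix.det_fin_two, h₂]⟩
  let T : Matrix.SpecialLinearGroup (Fin 2) ℂ := ⟨!![1, 0; 1, 1], by simp [Matrix.det_fin_two]⟩
  have hX := hp_sl_pow X p hp z₁ w₁ h₁ hz₁ hw₁ n₁ (by simp [X])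
  have hY := hp_sl_pow Y q hq z₂ w₂ h₂ hz₂ hw₂ n₂ (by simp [Y])
  have hXY := hp_sl_pow (X * Y) r hr z₃ w₃ h₃ hz₃ hw₃ n₃ (by
    rw [Matrix.SpecialLinearGroup.coe_mul]
    simp [X, Y, Matrix.mul_apply, Fin.sum_univ_two]; ring)
  refine ⟨Matrix.SpecialLinearGroup (Fin 2) ℂ ⧸
    Subgroup.center (Matrix.SpecialLinearGroup (Fin 2) ℂ), inferInstance,
    QuotientGroup.mk X, QuotientGroup.mk Y, (QuotientGroup.mk (X * Y))⁻¹, ?_, ?_, ?_, ?_, ?_⟩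
  · rw [← QuotientGroup.mk_mul, mul_inv_cancel]
  · rw [← QuotientGroup.mk_pow]; exact (QuotientGroup.eq_one_iff _).2 hX
  · rw [← QuotientGroup.mk_pow]; exact (QuotientGroup.eq_one_iff _).2 hY
  · rw [inv_pow, ← QuotientGroup.mk_pow, inv_eq_one]; exact (QuotientGroup.eq_one_iff _).2 hXY
  · intro h
    have h := (QuotientGroup.eq_one_iff _).1 h
    rw [Subgroup.mem_center_iff] at h
    have h4 := congrArg (fun M : Matrix.SpecialLinearGroup (Fin 2) ℂ => M 0 0) (h T)
    simp only [Matrix.SpecialLinearGroup.coe_mul] at h4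
    simp [X, T, Matrix.mul_apply, Fin.sum_univ_two] at h4

/-- For `n ≥ 3` and `aᵢ ≥ 2`, the group `G(a,b)` is nontrivial. -/
theorem homPlaneGroup_nontrivial (n : ℕ) (hn : 3 ≤ n) (a b : Fin n → ℤ)
    (ha : ∀ i, 2 ≤ a i) : Nontrivial (homPlaneGroup n a b) := by
  obtain ⟨m, rfl⟩ : ∃ m, n = m + 1 + 1 + 1 := ⟨n - 3, by omega⟩
  lift a to Fin (m + 1 + 1 + 1) → ℕ using fun i => by have := ha i; omega
  have ha' : ∀ i, 2 ≤ a i := fun i => by have h : (2 : ℤ) ≤ (a i : ℤ) := ha i; exact_mod_cast h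
  obtain ⟨H, _, x, y, z, hxyz, hx, hy, hz, hne⟩ :=
    hp_triangle (a 0) (a (Fin.succ 0)) (a (Fin.succ (Fin.succ 0))) (ha' _) (ha' _) (ha' _)
  let g : Fin (m + 1 + 1 + 1) → H := Fin.cons x (Fin.cons y (Fin.cons z fun _ => 1))
  let f : Fin (m + 1 + 1 + 1 + 1) → H := Fin.cons 1 g
  have hg : ∀ i, g i ^ a i = 1 := by
    intro i
    refine Fin.cases ?_ (fun i => Fin.cases ?_ (fun i => Fin.cases ?_ (fun i => ?_) i) i) i
    · simpa [g] using hx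
    · simpa [g] using hy
    · exact hz
    · simp [g]
  have hrel : ∀ r ∈ homPlaneRels (m + 1 + 1 + 1) (fun i => (a i : ℤ)) b,
      FreeGroup.lift f r = 1 := by
    rintro r ((hr | ⟨i, rfl⟩) | ⟨i, rfl⟩)
    · rw [Set.mem_singleton_iff.1 hr, map_mul, map_list_prod, List.map_ofFn]
      simp only [List.ofFn_succ, List.prod_cons, Function.comp, FreeGroup.lift_apply_of]
      simp [f, g, ← mul_assoc]
      exact hxyz
    · simp [f, commutatorElement_def]
    · simp [f, hg]
  let φ : PresentedGroup (homPlaneRels (m + 1 + 1 + 1) (fun i => (a i : ℤ)) b) →* H :=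
    PresentedGroup.toGroup hrel
  refine ⟨⟨(PresentedGroup.of (Fin.succ 0) : PresentedGroup _),
    (1 : PresentedGroup (homPlaneRels (m + 1 + 1 + 1) (fun i => (a i : ℤ)) b)), fun h => hne ?_⟩⟩
  have := congrArg φ h
  rw [map_one] at this
  simpa [φ, f, g] using this
end
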